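/- Let q ≥ 2 be an integer and let Π be a projective plane of order q. Then Π contains a saturating set S with |S| ≤ 2√((q+1)·ln q) + 3. -/

import Mathlib

/-- A (not necessarily Desarguesian) projective plane of order `q`:
a finite incidence structure of points and lines such that any two distinct
points lie on a unique common line, any two distinct lines meet in a unique
point, there exist four points no three collinear, and every line contains
exactly `q + 1` points. -/
structure ProjPlane (q : ℕ) where
  Point : Type
  Line : Type
  finite_point : Finite Point
  finite_line : Finite Line
  incid : Point → Line → Prop
  line_unique : ∀ P Q : Point, P ≠ Q → ∃! l : Line, incid P l ∧ incid Q l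
  point_unique : ∀ l m : Line, l ≠ m → ∃! P : Point, incid P l ∧ incid P m
  nondeg : ∃ P₁ P₂ P₃ P₄ : Point,
    P₁ ≠ P₂ ∧ P₁ ≠ P₃ ∧ P₁ ≠ P₄ ∧ P₂ ≠ P₃ ∧ P₂ ≠ P₄ ∧ P₃ ≠ P₄ ∧
    (∀ l : Line, ¬(incid P₁ l ∧ incid P₂ l ∧ incid P₃ l)) ∧
    (∀ l : Line, ¬(incid P₁ l ∧ incid P₂ l ∧ incid P₄ l)) ∧
    (∀ l : Line, ¬(incid P₁ l ∧ incid P₃ l ∧ incid P₄ l)) ∧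
    (∀ l : Line, ¬(incid P₂ l ∧ incid P₃ l ∧ incid P₄ l))
  line_card : ∀ l : Line, Nat.card {P : Point // incid P l} = q + 1

/-- A point set `S` is saturating if every point of the plane not in `S`
lies on a line containing at least two points of `S`. -/
def ProjPlane.Saturating {q : ℕ} (PP : ProjPlane q) (S : Set PP.Point) : Prop :=
  ∀ Q : PP.Point, Q ∉ S → ∃ A ∈ S, ∃ B ∈ S, A ≠ B ∧
    ∃ l : PP.Line, PP.incid A l ∧ PP.incid B l ∧ PP.incid Q l

/-- `R(T)`: the set of points of the plane not in `T` that do not lie on any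
line containing at least two points of `T` (the points not covered by `T`). -/
def ProjPlane.uncov {q : ℕ} (PP : ProjPlane q) (T : Set PP.Point) : Set PP.Point :=
  {Q : PP.Point | Q ∉ T ∧ ¬ ∃ A ∈ T, ∃ B ∈ T, A ≠ B ∧
    ∃ l : PP.Line, PP.incid A l ∧ PP.incid B l ∧ PP.incid Q l}

namespace ProjPlane

variable {q : ℕ} (PP : ProjPlane q)

theorem exists_line_function :
    ∃ f : PP.Point → PP.Point → PP.Line, ∀ P Q, PP.incid P (f P Q) ∧ PP.incid Q (f P Q) := by
  have key : ∀ P Q : PP.Point, ∃ l : PP.Line, PP.incid P l ∧ PP.incid Q l := by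
    intro P Q
    by_cases h : P = Q
    · subst h
      obtain ⟨P₁, P₂, -, -, h12, -⟩ := PP.nondeg
      by_cases h1 : P = P₁
      · obtain ⟨l, hl, -⟩ := PP.line_unique P P₂ (h1 ▸ h12)
        exact ⟨l, hl.1, hl.1⟩
      · obtain ⟨l, hl, -⟩ := PP.line_unique P P₁ h1
        exact ⟨l, hl.1, hl.1⟩
    · exact (PP.line_unique P Q h).exists
  choose f hf using key
  exact ⟨f, hf⟩

theorem line_eq {P Q : PP.Point} (h : P ≠ Q) {l m : PP.Line} (hPl : PP.incid P l)
    (hQl : PP.incid Q l) (hPm : PP.incid P m) (hQm : PP.incid Q m) : l = m :=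
  (PP.line_unique P Q h).unique ⟨hPl, hQl⟩ ⟨hPm, hQm⟩

theorem exists_antiflag : ∃ (P : PP.Point) (l : PP.Line), ¬ PP.incid P l := by
  obtain ⟨P₁, P₂, P₃, -, h12, -, -, -, -, -, h, -⟩ := PP.nondeg
  obtain ⟨l, hl, -⟩ := PP.line_unique P₁ P₂ h12
  exact ⟨P₃, l, fun h3 => h l ⟨hl.1, hl.2, h3⟩⟩

/-- The union of a line and a point off it is saturating. -/
theorem exists_saturating_ncard_le :
    ∃ S : Set PP.Point, PP.Saturating S ∧ S.ncard ≤ q + 2 := by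
  obtain ⟨P, l, hP⟩ := PP.exists_antiflag
  refine ⟨insert P {X | PP.incid X l}, ?_, ?_⟩
  · intro Q hQ
    have hPQ : P ≠ Q := fun h => hQ (h ▸ Set.mem_insert _ _)
    obtain ⟨m, hm, -⟩ := PP.line_unique P Q hPQ
    obtain ⟨X, hX, -⟩ := PP.point_unique l m (fun h => hP (h ▸ hm.1))
    exact ⟨P, Set.mem_insert _ _, X, Set.mem_insert_of_mem _ hX.1,
      fun h => hP (h ▸ hX.1), m, hm.1, hX.2, hm.2⟩
  · refine (Set.ncard_insert_le _ _).trans ?_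
    have : Set.ncard {X | PP.incid X l} = q + 1 := PP.line_card l
    omega

open scoped Classical in
/-- The points of a line, as a finset. -/
noncomputable def pts [Fintype PP.Point] (l : PP.Line) : Finset PP.Point :=
  Finset.univ.filter (PP.incid · l)

theorem mem_pts [Fintype PP.Point] {l : PP.Line} {P : PP.Point} :
    P ∈ PP.pts l ↔ PP.incid P l := by
  simp [pts]

theorem card_pts [Fintype PP.Point] (l : PP.Line) : (PP.pts l).card = q + 1 := by
  classical
  rw [← PP.line_card l, Nat.card_eq_fintype_card, Fintype.card_subtype, pts]

theorem card_point_le [Fintype PP.Point] : Fintype.card PP.Point ≤ q ^ 2 + q + 1 := by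
  classical
  obtain ⟨f, hf⟩ := PP.exists_line_function
  obtain ⟨P, l, hP⟩ := PP.exists_antiflag
  have hsub : (Finset.univ : Finset PP.Point) ⊆
      insert P ((PP.pts l).biUnion fun X => (PP.pts (f P X)).erase P) := by
    intro Q _
    by_cases hQ : Q = P
    · simp [hQ]
    · obtain ⟨X, hX, -⟩ := PP.point_unique l (f P Q) (fun h => hP (h ▸ (hf P Q).1))
      have hPX : P ≠ X := fun h => hP (h ▸ hX.1)
      have := PP.line_eq hPX (hf P Q).1 hX.2 (hf P X).1 (hf P X).2
      refine Finset.mem_insert_of_mem (Finset.mem_biUnion.2 ⟨X, PP.mem_pts.2 hX.1, ?_⟩)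
      exact Finset.mem_erase.2 ⟨hQ, PP.mem_pts.2 (this ▸ (hf P Q).2)⟩
  have h1 := Finset.card_le_card hsub
  have h2 := Finset.card_insert_le P ((PP.pts l).biUnion fun X => (PP.pts (f P X)).erase P)
  have h3 := Finset.card_biUnion_le_card_mul (PP.pts l)
    (fun X => (PP.pts (f P X)).erase P) q (fun X _ => by
      rw [Finset.card_erase_of_mem (PP.mem_pts.2 (hf P X).1), card_pts]; omega)
  rw [card_pts] at h3
  rw [Finset.card_univ] at h1
  nlinarith

theorem uncov_insert_subset (T : Set PP.Point) (Q : PP.Point) :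
    PP.uncov (insert Q T) ⊆ PP.uncov T := by
  rintro P ⟨hP, h⟩
  refine ⟨fun hT => hP (Set.mem_insert_of_mem _ hT), ?_⟩
  rintro ⟨A, hA, B, hB, hAB⟩
  exact h ⟨A, Set.mem_insert_of_mem _ hA, B, Set.mem_insert_of_mem _ hB, hAB⟩

/-- An uncovered point becomes covered after adding any of at least `|T| (q - 1) + 1` points. -/
theorem exists_covering_finset [Fintype PP.Point] (hq : 2 ≤ q) (T : Finset PP.Point)
    {P : PP.Point} (hP : P ∈ PP.uncov T) :
    ∃ B : Finset PP.Point, T.card * (q - 1) + 1 ≤ B.card ∧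
      ∀ Q ∈ B, P ∉ PP.uncov (insert Q (T : Set PP.Point)) := by
  classical
  obtain ⟨f, hf⟩ := PP.exists_line_function
  obtain ⟨hPT, hcov⟩ := hP
  have hne : ∀ A ∈ T, A ≠ P := fun A hA h => hPT (h ▸ hA)
  let g : PP.Point → Finset PP.Point := fun A => ((PP.pts (f P A)).erase P).erase A
  refine ⟨insert P (T.biUnion g), ?_, ?_⟩
  · rw [Finset.card_insert_of_notMem (by simp [g]), Finset.card_biUnion]
    · rw [Finset.sum_const_nat (m := q - 1)]
      intro A hA
      rw [Finset.card_erase_of_mem, Finset.card_erase_of_mem, card_pts]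
      · omega
      · exact PP.mem_pts.2 (hf P A).1
      · exact Finset.mem_erase.2 ⟨hne A hA, PP.mem_pts.2 (hf P A).2⟩
    · intro A hA A' hA' hAA'
      rw [Function.onFun, Finset.disjoint_left]
      intro X hX hX'
      simp only [g, Finset.mem_erase, mem_pts] at hX hX'
      have := PP.line_eq (Ne.symm hX.2.1) (hf P A).1 hX.2.2 (hf P A').1 hX'.2.2
      exact hcov ⟨A, hA, A', hA', hAA', f P A, (hf P A).2, this ▸ (hf P A').2, (hf P A).1⟩
  · intro Q hQ hPQ
    rcases Finset.mem_insert.1 hQ with rfl | hQ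
    · exact hPQ.1 (Set.mem_insert _ _)
    · obtain ⟨A, hA, hQA⟩ := Finset.mem_biUnion.1 hQ
      simp only [g, Finset.mem_erase, mem_pts] at hQA
      exact hPQ.2 ⟨Q, Set.mem_insert _ _, A, Set.mem_insert_of_mem _ hA, hQA.1, f P A,
        hQA.2.2, (hf P A).2, (hf P A).1⟩

/-- Averaging over all points `Q` gives one whose addition covers many uncovered points. -/
theorem exists_insert_uncov_ncard_le [Fintype PP.Point] (hq : 2 ≤ q) (T : Finset PP.Point) :
    ∃ Q : PP.Point, (PP.uncov (insert Q (T : Set PP.Point))).ncard * Fintype.card PP.Point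
      + (PP.uncov T).ncard * (T.card * (q - 1) + 1)
      ≤ (PP.uncov T).ncard * Fintype.card PP.Point := by
  classical
  have hB : ∀ P : PP.Point, ∃ B : Finset PP.Point, P ∈ PP.uncov T →
      (T.card * (q - 1) + 1 ≤ B.card ∧
        ∀ Q ∈ B, P ∉ PP.uncov (insert Q (T : Set PP.Point))) := by
    intro P
    by_cases hP : P ∈ PP.uncov T
    · obtain ⟨B, h⟩ := PP.exists_covering_finset hq T hP
      exact ⟨B, fun _ => h⟩
    · exact ⟨∅, fun h => absurd h hP⟩
  choose B hB using hB
  have hcard : ∀ X : Set PP.Point, X.ncard = X.toFinset.card :=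
    fun X => Set.ncard_eq_toFinset_card' X
  simp only [hcard]
  set U := (PP.uncov (T : Set PP.Point)).toFinset
  set n := Fintype.card PP.Point with hn
  set c := T.card * (q - 1) + 1
  have hsum : ∑ Q : PP.Point, ((PP.uncov (insert Q (T : Set PP.Point))).toFinset.card)
      + U.card * c ≤ U.card * n := by
    calc _ ≤ ∑ Q : PP.Point, (U.filter (fun P => Q ∉ B P)).card + ∑ P ∈ U, (B P).card := by
          gcongr with Q hQ
          · intro P hP
            rw [Set.mem_toFinset] at hP
            have hPU := PP.uncov_insert_subset _ _ hP
            exact Finset.mem_filter.2 ⟨Set.mem_toFinset.2 hPU, fun h => (hB P hPU).2 Q h hP⟩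
          · rw [← smul_eq_mul]
            exact Finset.card_nsmul_le_sum _ _ _ fun P hP => (hB P (Set.mem_toFinset.1 hP)).1
      _ = ∑ P ∈ U, ((Finset.univ.filter (fun Q => Q ∉ B P)).card + (B P).card) := by
          rw [Finset.sum_add_distrib]
          congr 1
          exact Finset.sum_card_bipartiteAbove_eq_sum_card_bipartiteBelow
            (s := Finset.univ) (t := U) (fun Q P => Q ∉ B P)
      _ = ∑ P ∈ U, n := by
          refine Finset.sum_congr rfl fun P _ => ?_
          have h := Finset.card_filter_add_card_filter_not (s := Finset.univ) (fun Q => Q ∈ B P)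
          simp only [Finset.filter_univ_mem, Finset.card_univ] at h
          omega
      _ = U.card * n := by simp
  have hne : (Finset.univ : Finset PP.Point).Nonempty :=
    let ⟨P, _⟩ := PP.exists_antiflag; ⟨P, Finset.mem_univ _⟩
  obtain ⟨Q, -, hQ⟩ := Finset.exists_min_image Finset.univ
    (fun Q => (PP.uncov (insert Q (T : Set PP.Point))).toFinset.card) hne
  refine ⟨Q, le_trans ?_ hsum⟩
  gcongr
  rw [mul_comm, hn, ← Finset.card_univ, ← smul_eq_mul]
  exact Finset.card_nsmul_le_sum _ _ _ fun X hX => hQ X hX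

/-- The greedy algorithm: after `k` steps either nothing is uncovered or the number of uncovered
points has decayed exponentially in `k²`. -/
theorem exists_finset_uncov_ncard_le [Fintype PP.Point] (hq : 2 ≤ q) (k : ℕ) :
    ∃ T : Finset PP.Point, T.card ≤ k ∧ (PP.uncov T = ∅ ∨ (T.card = k ∧
      ((PP.uncov T).ncard : ℝ) ≤ (q ^ 2 + q + 1 : ℝ) *
        Real.exp (-(((q - 1 : ℝ) * (k * (k - 1) / 2) + k) / (q ^ 2 + q + 1 : ℝ))))) := by
  classical
  have hN : (Fintype.card PP.Point : ℝ) ≤ q ^ 2 + q + 1 := by exact_mod_cast PP.card_point_le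
  induction k with
  | zero =>
    refine ⟨∅, le_rfl, Or.inr ⟨rfl, ?_⟩⟩
    have h1 : (PP.uncov ((∅ : Finset PP.Point) : Set PP.Point)).ncard ≤ Fintype.card PP.Point := by
      rw [← Nat.card_eq_fintype_card]
      exact Set.ncard_le_card _
    have h2 : ((PP.uncov ((∅ : Finset PP.Point) : Set PP.Point)).ncard : ℝ)
        ≤ Fintype.card PP.Point := by exact_mod_cast h1
    simpa using h2.trans hN
  | succ k ih =>
    obtain ⟨T, hTk, hT | ⟨hTc, hT⟩⟩ := ih
    · exact ⟨T, by omega, Or.inl hT⟩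
    by_cases hU : PP.uncov (T : Set PP.Point) = ∅
    · exact ⟨T, by omega, Or.inl hU⟩
    obtain ⟨Q, hQ⟩ := PP.exists_insert_uncov_ncard_le hq T
    have hUpos : 0 < (PP.uncov (T : Set PP.Point)).ncard :=
      (Set.ncard_pos).2 (Set.nonempty_iff_ne_empty.2 hU)
    have hQT : Q ∉ T := by
      intro h
      rw [Set.insert_eq_of_mem (Finset.mem_coe.2 h)] at hQ
      have : 0 < (PP.uncov (T : Set PP.Point)).ncard * (T.card * (q - 1) + 1) := by positivity
      omega
    have hc : (insert Q T).card = k + 1 := by rw [Finset.card_insert_of_notMem hQT, hTc]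
    refine ⟨insert Q T, hc.le, Or.inr ⟨hc, ?_⟩⟩
    rw [Finset.coe_insert]
    have hQ' : ((PP.uncov (insert Q (T : Set PP.Point))).ncard : ℝ) * Fintype.card PP.Point
        + (PP.uncov (T : Set PP.Point)).ncard * (k * (q - 1) + 1)
        ≤ (PP.uncov (T : Set PP.Point)).ncard * Fintype.card PP.Point := by
      have := (Nat.cast_le (α := ℝ)).2 hQ
      rw [hTc] at this
      push_cast [Nat.cast_sub (show 1 ≤ q by omega)] at this
      exact this
    have hn : (0 : ℝ) < Fintype.card PP.Point := by exact_mod_cast Fintype.card_pos_iff.2 ⟨Q⟩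
    have hq1 : (2 : ℝ) ≤ q := by exact_mod_cast hq
    set u := ((PP.uncov (T : Set PP.Point)).ncard : ℝ)
    set v := ((PP.uncov (insert Q (T : Set PP.Point))).ncard : ℝ)
    set n := (Fintype.card PP.Point : ℝ)
    have hu0 : 0 ≤ u := Nat.cast_nonneg _
    set N : ℝ := q ^ 2 + q + 1
    set c : ℝ := k * (q - 1) + 1 with hcdef
    have hc0 : 0 ≤ c := by
      have : (0 : ℝ) ≤ q - 1 := by linarith
      positivity
    have hN0 : 0 < N := by positivity
    have h1 : v ≤ u * (1 - c / n) := by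
      have : u * (1 - c / n) = (u * n - u * c) / n := by field_simp
      rw [this, le_div_iff₀ hn]
      linarith
    have h2 : 1 - c / n ≤ Real.exp (-(c / N)) := by
      have h3 : c / N ≤ c / n := by gcongr
      have h4 := Real.add_one_le_exp (-(c / N))
      linarith
    calc v ≤ u * (1 - c / n) := h1
      _ ≤ u * Real.exp (-(c / N)) := by gcongr
      _ ≤ _ := mul_le_mul_of_nonneg_right hT (Real.exp_pos _).le
      _ = _ := by
        rw [mul_assoc, ← Real.exp_add]
        congr 2
        rw [hcdef]
        push_cast
        field_simp
        ring

theorem saturating_union_uncov (T : Set PP.Point) : PP.Saturating (T ∪ PP.uncov T) := by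
  intro Q hQ
  by_contra h
  refine hQ (Or.inr ⟨fun hT => hQ (Or.inl hT), ?_⟩)
  rintro ⟨A, hA, B, hB, hAB⟩
  exact h ⟨A, Or.inl hA, B, Or.inl hB, hAB⟩

end ProjPlane

theorem sub_one_le_two_mul_sqrt_of_le_ten {q : ℕ} (hq : 2 ≤ q) (hq' : q ≤ 10) :
    (q : ℝ) - 1 ≤ 2 * Real.sqrt ((q + 1) * Real.log q) := by
  have hl2 := Real.log_two_gt_d9
  have hlog : ∀ j : ℕ, 2 ^ j ≤ q → j * 0.693 ≤ Real.log q := by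
    intro j hj
    have h1 : Real.log ((2 : ℝ) ^ j) ≤ Real.log q :=
      Real.log_le_log (by positivity) (by exact_mod_cast hj)
    rw [Real.log_pow] at h1
    have : (j : ℝ) * 0.693 ≤ j * Real.log 2 := by gcongr; linarith
    linarith
  have key : ((q : ℝ) - 1) / 2 ≤ Real.sqrt ((q + 1) * Real.log q) := by
    apply Real.le_sqrt_of_sq_le
    have h1 := hlog 1
    have h2 := hlog 2
    have h3 := hlog 3
    interval_cases q <;> norm_num at h1 h2 h3 ⊢ <;> linarith
  linarith

theorem log_le_sub_one_div_four {x : ℝ} (hx : 11 ≤ x) : Real.log x ≤ (x - 1) / 4 := by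
  have h := Real.log_le_sub_one_of_pos (show 0 < x / 2 ^ 3 by positivity)
  rw [Real.log_div (by positivity) (by positivity), Real.log_pow] at h
  have := Real.log_two_lt_d9
  push_cast at h
  linarith

/-- The number of uncovered points is below two after sufficiently many greedy steps. -/
theorem mul_exp_neg_lt_two {x k : ℝ} (hx : 11 ≤ x)
    (hk : 2 * Real.sqrt ((x + 1) * Real.log x) + 1 ≤ k) :
    (x ^ 2 + x + 1) * Real.exp (-(((x - 1) * (k * (k - 1) / 2) + k) / (x ^ 2 + x + 1))) < 2 := by
  set L := Real.log x with hL
  set s := Real.sqrt ((x + 1) * L)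
  have hL4 : L ≤ (x - 1) / 4 := log_le_sub_one_div_four hx
  have hL0 : 0 ≤ L := Real.log_nonneg (by linarith)
  have hs0 : 0 ≤ s := Real.sqrt_nonneg _
  have hs2 : s ^ 2 = (x + 1) * L := Real.sq_sqrt (by positivity)
  have hbound : 2 * (x + 2) * L ≤ (x + 1) * s := by
    refine (sq_le_sq₀ (by positivity) (by positivity)).1 ?_
    have h1 : 4 * (x + 2) ^ 2 * L ≤ (x + 1) ^ 3 := by nlinarith
    calc (2 * (x + 2) * L) ^ 2 = (4 * (x + 2) ^ 2 * L) * L := by ring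
      _ ≤ (x + 1) ^ 3 * L := by gcongr
      _ = ((x + 1) * s) ^ 2 := by rw [mul_pow, hs2]; ring
  have hkk : (2 * s + 1) * (2 * s) ≤ k * (k - 1) := by
    apply mul_le_mul hk (by linarith) (by positivity) (by linarith)
  have hmain : 2 * L ≤ ((x - 1) * (k * (k - 1) / 2) + k) / (x ^ 2 + x + 1) := by
    rw [le_div_iff₀ (by positivity)]
    have h2 : (x - 1) * ((2 * s + 1) * (2 * s) / 2) ≤ (x - 1) * (k * (k - 1) / 2) := by
      have : 0 ≤ x - 1 := by linarith
      gcongr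
    nlinarith
  have hexp : Real.exp (-(((x - 1) * (k * (k - 1) / 2) + k) / (x ^ 2 + x + 1))) ≤ 1 / x ^ 2 := by
    calc _ ≤ Real.exp (-(2 * L)) := Real.exp_le_exp.2 (neg_le_neg hmain)
      _ = 1 / x ^ 2 := by
        rw [Real.exp_neg, hL, show 2 * Real.log x = Real.log (x ^ 2) by rw [Real.log_pow]; norm_num,
          Real.exp_log (by positivity), one_div]
  calc _ ≤ (x ^ 2 + x + 1) * (1 / x ^ 2) := by gcongr
    _ < 2 := by
      rw [mul_one_div, div_lt_iff₀ (by positivity)]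
      nlinarith

theorem saturating_set_bound_xi_one (q : ℕ) (hq : 2 ≤ q) (PP : ProjPlane q) :
    ∃ S : Set PP.Point, PP.Saturating S ∧
      (S.ncard : ℝ) ≤ 2 * Real.sqrt ((q + 1) * Real.log q) + 3 := by
  rcases Nat.lt_or_ge 10 q with hq10 | hq10
  · have := PP.finite_point
    have := Fintype.ofFinite PP.Point
    set M : ℝ := 2 * Real.sqrt ((q + 1) * Real.log q)
    have hM0 : 0 ≤ M := by positivity
    obtain ⟨T, hTk, hT⟩ := PP.exists_finset_uncov_ncard_le hq (⌊M⌋₊ + 2)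
    have hU : (PP.uncov (T : Set PP.Point)).ncard ≤ 1 := by
      rcases hT with hT | ⟨-, hT⟩
      · simp [hT]
      · have hlt := hT.trans_lt (mul_exp_neg_lt_two (by exact_mod_cast hq10) (by
          push_cast
          linarith [Nat.lt_floor_add_one M]))
        have : (PP.uncov (T : Set PP.Point)).ncard < 2 := by exact_mod_cast hlt
        omega
    refine ⟨_, PP.saturating_union_uncov T, ?_⟩
    have h1 := Set.ncard_union_le (T : Set PP.Point) (PP.uncov T)
    rw [Set.ncard_coe_finset] at h1
    have h2 : ((T : Set PP.Point) ∪ PP.uncov T).ncard ≤ ⌊M⌋₊ + 3 := by omega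
    have h3 : ((((T : Set PP.Point) ∪ PP.uncov T).ncard : ℕ) : ℝ) ≤ ⌊M⌋₊ + 3 := by
      exact_mod_cast h2
    linarith [Nat.floor_le hM0]
  · obtain ⟨S, hS, hcard⟩ := PP.exists_saturating_ncard_le
    refine ⟨S, hS, ?_⟩
    have h1 : (S.ncard : ℝ) ≤ q + 2 := by exact_mod_cast hcard
    linarith [sub_one_le_two_mul_sqrt_of_le_ten hq hq10]
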